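/- arXiv:2011.14119 — 2 statements merged into one kernel-verified Lean document; each statement's English description precedes it below -/
import Mathlib

section
/- Let n ≥ q ≥ 1 be integers with n + q even. Then ∫_0^∞ sin(x)^n / x^q dx = ((−1)^{(q−n)/2} π / (2^n (q−1)!)) · Σ_{k=0}^{⌊(n−1)/2⌋} (−1)^k C(n,k) (n−2k)^{q−1}. -/
open Filter Finset Real

lemma aux_contDiff_sinc : ContDiff ℝ ⊤ sinc := by
  rw [contDiff_iff_contDiffAt]
  intro x
  by_cases hx : x = 0
  · subst hx
    rw [sinc_eq_dslope]
    have h : AnalyticAt ℝ sin 0 := Real.analyticAt_sin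
    obtain ⟨p, hp⟩ := h
    have := hp.has_fpower_series_dslope_fslope
    exact (AnalyticAt.contDiffAt ⟨_, this⟩)
  · have h : (fun y => sin y / y) =ᶠ[nhds x] sinc := by
      filter_upwards [isOpen_ne.mem_nhds hx] with y hy
      rw [sinc_of_ne_zero hy]
    refine ContDiffAt.congr_of_eventuallyEq ?_ h.symm
    exact Real.contDiff_sin.contDiffAt.div contDiffAt_id hx

lemma aux_inner (R t : ℝ) :
    ∫ x in (0:ℝ)..R, exp (-(x * t)) * sin x =
      (1 + t ^ 2)⁻¹ - exp (-(R * t)) * (cos R + t * sin R) / (1 + t ^ 2) := by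
  have ht : 1 + t ^ 2 ≠ 0 := by positivity
  have hd : ∀ x ∈ Set.uIcc 0 R,
      HasDerivAt (fun x => - (exp (-(x * t)) * (cos x + t * sin x) / (1 + t ^ 2)))
        (exp (-(x * t)) * sin x) x := by
    intro x _
    have h1 : HasDerivAt (fun x : ℝ => exp (-(x * t))) (exp (-(x * t)) * (-(1 * t))) x :=
      ((hasDerivAt_id x).mul_const t).neg.exp
    have h2 := (Real.hasDerivAt_cos x).add ((Real.hasDerivAt_sin x).const_mul t)
    have h3 := ((h1.mul h2).div_const (1 + t ^ 2)).neg
    refine HasDerivAt.congr_deriv h3 ?_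
    change -((exp (-(x * t)) * (-(1 * t)) * (cos x + t * sin x) +
      exp (-(x * t)) * (-sin x + t * cos x)) / (1 + t ^ 2)) = _
    field_simp
    ring
  rw [intervalIntegral.integral_eq_sub_of_hasDerivAt hd
    (by apply Continuous.intervalIntegrable; fun_prop)]
  simp
  ring

lemma aux_fubini (R : ℝ) (hR : 0 < R) :
    ∫ x in (0:ℝ)..R, sinc x =
      ∫ t in Set.Ioi (0:ℝ), ((1 + t ^ 2)⁻¹ - exp (-(R * t)) * (cos R + t * sin R) / (1 + t ^ 2)) := by
  have hI : ∀ x : ℝ, 0 < x → MeasureTheory.IntegrableOn (fun t => exp (-(x * t))) (Set.Ioi 0) := by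
    intro x hx
    have := integrableOn_exp_mul_Ioi (a := -x) (by linarith) 0
    simpa using this
  have hV : ∀ x : ℝ, 0 < x → ∫ t in Set.Ioi (0:ℝ), exp (-(x * t)) = 1 / x := by
    intro x hx
    have := integral_exp_mul_Ioi (a := -x) (by linarith) 0
    simpa using this
  have hint : MeasureTheory.Integrable (Function.uncurry fun x t : ℝ => exp (-(x * t)) * sin x)
      ((MeasureTheory.volume.restrict (Set.Ioc 0 R)).prod
        (MeasureTheory.volume.restrict (Set.Ioi 0))) := by
    rw [MeasureTheory.integrable_prod_iff]
    · constructor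
      · filter_upwards [MeasureTheory.ae_restrict_mem measurableSet_Ioc] with x hx
        exact (hI x hx.1).mul_const (sin x)
      · have : MeasureTheory.IntegrableOn (fun x => |sinc x|) (Set.Ioc 0 R) :=
          (continuous_sinc.abs.integrableOn_Icc).mono_set Set.Ioc_subset_Icc_self
        refine MeasureTheory.Integrable.congr this ?_
        filter_upwards [MeasureTheory.ae_restrict_mem measurableSet_Ioc] with x hx
        simp only [Function.uncurry, norm_mul, Real.norm_eq_abs, abs_exp]
        rw [MeasureTheory.integral_mul_const, hV x hx.1, sinc_of_ne_zero hx.1.ne', abs_div,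
          abs_of_pos hx.1]
        ring
    · apply Continuous.aestronglyMeasurable
      fun_prop
  have := MeasureTheory.integral_integral_swap hint
  rw [intervalIntegral.integral_of_le hR.le]
  calc _ = ∫ x in Set.Ioc 0 R, ∫ t in Set.Ioi (0:ℝ), exp (-(x * t)) * sin x := by
        apply MeasureTheory.setIntegral_congr_fun measurableSet_Ioc
        intro x hx
        simp only
        rw [MeasureTheory.integral_mul_const, hV x hx.1, sinc_of_ne_zero hx.1.ne']
        ring
    _ = _ := this
    _ = _ := by
        congr 1
        ext t
        rw [← intervalIntegral.integral_of_le hR.le, aux_inner]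

lemma aux_dirichlet : Tendsto (fun R => ∫ x in (0:ℝ)..R, sinc x) atTop (nhds (π / 2)) := by
  rw [tendsto_iff_norm_sub_tendsto_zero]
  have h0 : Tendsto (fun R : ℝ => 2 * (1 / R)) atTop (nhds 0) := by
    simpa using (tendsto_inv_atTop_zero (𝕜 := ℝ)).const_mul 2
  refine tendsto_of_tendsto_of_tendsto_of_le_of_le' tendsto_const_nhds h0
    (Eventually.of_forall fun _ => norm_nonneg _) ?_
  filter_upwards [eventually_gt_atTop 0] with R hR
  have hI : MeasureTheory.IntegrableOn (fun t => 2 * exp (-(R * t))) (Set.Ioi 0) := by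
    have := integrableOn_exp_mul_Ioi (a := -R) (by linarith) 0
    have h2 := MeasureTheory.Integrable.const_mul this 2
    simp only [neg_mul] at h2
    exact h2
  have hV : ∫ t in Set.Ioi (0:ℝ), 2 * exp (-(R * t)) = 2 * (1 / R) := by
    have := integral_exp_mul_Ioi (a := -R) (by linarith) 0
    rw [MeasureTheory.integral_const_mul]
    simpa using this
  have hb : ∀ t ∈ Set.Ioi (0:ℝ),
      ‖exp (-(R * t)) * (cos R + t * sin R) / (1 + t ^ 2)‖ ≤ 2 * exp (-(R * t)) := by
    intro t ht
    have ht : 0 < t := ht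
    rw [norm_div, norm_mul, Real.norm_eq_abs, Real.norm_eq_abs, Real.norm_eq_abs, abs_exp,
      abs_of_pos (by positivity : 0 < 1 + t ^ 2), div_le_iff₀ (by positivity)]
    have : |cos R + t * sin R| ≤ 1 + t := by
      refine (abs_add_le _ _).trans ?_
      rw [abs_mul, abs_of_pos ht]
      have := abs_cos_le_one R
      have := abs_sin_le_one R
      nlinarith
    have h2 : |cos R + t * sin R| ≤ 2 * (1 + t ^ 2) := by nlinarith [sq_nonneg (t - 1)]
    calc _ ≤ exp (-(R * t)) * (2 * (1 + t ^ 2)) := by gcongr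
      _ = _ := by ring
  have hE : MeasureTheory.IntegrableOn
      (fun t => exp (-(R * t)) * (cos R + t * sin R) / (1 + t ^ 2)) (Set.Ioi 0) := by
    refine MeasureTheory.Integrable.mono' hI ?_ ?_
    · apply Continuous.aestronglyMeasurable
      refine Continuous.div (by fun_prop) (by fun_prop) ?_
      intro t; positivity
    · filter_upwards [MeasureTheory.ae_restrict_mem measurableSet_Ioi] with t ht using hb t ht
  rw [aux_fubini R hR, MeasureTheory.integral_sub integrable_inv_one_add_sq.integrableOn hE,
    integral_Ioi_inv_one_add_sq]
  simp only [arctan_zero, sub_zero, sub_sub_cancel_left, norm_neg]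
  rw [← hV]
  refine MeasureTheory.norm_integral_le_of_norm_le hI ?_
  filter_upwards [MeasureTheory.ae_restrict_mem measurableSet_Ioi] with t ht using hb t ht

lemma aux_dirichlet_scaled (a : ℝ) :
    Tendsto (fun R => ∫ x in (0:ℝ)..R, a * sinc (a * x)) atTop
      (nhds (π / 2 * (SignType.sign a : ℝ))) := by
  have hs : ∀ R, ∫ x in (0:ℝ)..R, a * sinc (a * x) = ∫ x in (0:ℝ)..(a * R), sinc x := by
    intro R
    rw [intervalIntegral.integral_const_mul, intervalIntegral.mul_integral_comp_mul_left]
    simp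
  simp only [hs]
  rcases lt_trichotomy a 0 with ha | ha | ha
  · have h1 : ∀ R, ∫ x in (0:ℝ)..(a * R), sinc x = - ∫ x in (0:ℝ)..((-a) * R), sinc x := by
      intro R
      have := intervalIntegral.integral_comp_neg (a := 0) (b := -a * R) sinc
      simp only [sinc_neg] at this
      rw [this, intervalIntegral.integral_symm]
      simp
    simp only [h1, sign_neg ha]
    have := (aux_dirichlet.comp (tendsto_id.const_mul_atTop (neg_pos.2 ha))).neg
    simpa [Function.comp_def] using this
  · subst ha; simp
  · simp only [sign_pos ha]
    simpa [Function.comp_def] using aux_dirichlet.comp (tendsto_id.const_mul_atTop ha)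

lemma aux_key (s : Finset ℕ) (a : ℕ → ℝ) (q : ℕ) : ∀ (c : ℕ → ℝ) (φ : ℝ) (h : ℝ → ℝ),
    ContDiff ℝ ((⊤ : ℕ∞) : WithTop ℕ∞) h → (∀ x, ∑ j ∈ s, c j * sin (a j * x + φ) = x ^ (q + 1) * h x) →
    sin (φ + q * (π / 2)) = 0 →
    Tendsto (fun R => ∫ x in (0:ℝ)..R, h x) atTop
      (nhds (π / 2 * cos (φ + q * (π / 2)) / (q.factorial : ℝ) *
        ∑ j ∈ s, c j * a j ^ q * (SignType.sign (a j) : ℝ))) := by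
  induction q with
  | zero =>
    intro c φ h _ hx hφ
    simp only [Nat.cast_zero, zero_mul, add_zero, zero_add, pow_one, pow_zero, mul_one] at *
    have hh : ∀ x, x ≠ 0 → h x = ∑ j ∈ s, cos φ * c j * (a j * sinc (a j * x)) := by
      intro x hx0
      have h1 := hx x
      apply mul_left_cancel₀ hx0
      rw [← h1, Finset.mul_sum]
      refine Finset.sum_congr rfl fun j _ => ?_
      rw [sin_add, hφ]
      by_cases ha : a j = 0
      · simp [ha]
      · rw [sinc_of_ne_zero (mul_ne_zero ha hx0)]
        field_simp
        ring
    have h2 : (fun R => ∑ j ∈ s, cos φ * c j * ∫ x in (0:ℝ)..R, (a j * sinc (a j * x)))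
        =ᶠ[atTop] fun R => ∫ x in (0:ℝ)..R, h x := by
      filter_upwards [eventually_gt_atTop 0] with R hR
      have hi : ∀ j, Continuous fun x => cos φ * c j * (a j * sinc (a j * x)) := by
        intro j
        have := continuous_sinc
        fun_prop
      simp only [← intervalIntegral.integral_const_mul]
      rw [← intervalIntegral.integral_finsetSum
        (fun j _ => (hi j).intervalIntegrable _ _)]
      rw [intervalIntegral.integral_of_le hR.le, intervalIntegral.integral_of_le hR.le]
      apply MeasureTheory.setIntegral_congr_fun measurableSet_Ioc
      intro x hx
      simp only
      rw [hh x hx.1.ne']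
    refine Tendsto.congr' h2 ?_
    have := tendsto_finsetSum s fun j _ => (aux_dirichlet_scaled (a j)).const_mul (cos φ * c j)
    convert this using 2
    rw [Finset.mul_sum]
    refine Finset.sum_congr rfl fun j _ => ?_
    simp
    ring
  | succ q ih =>
    intro c φ h hh hx hφ
    have hd : Differentiable ℝ h := hh.differentiable (by simp)
    have hd' : ContDiff ℝ ((⊤ : ℕ∞) : WithTop ℕ∞) (deriv h) := ContDiff.iterate_deriv 1 hh
    have key := ih (fun j => c j * a j) (φ + π / 2) (fun x => (q + 2) * h x + x * deriv h x)
      (by fun_prop) ?_ ?_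
    · have hint : ∀ R, ∫ x in (0:ℝ)..R, h x =
          ((∫ x in (0:ℝ)..R, ((q + 2) * h x + x * deriv h x)) - R * h R) / (q + 1) := by
        intro R
        have h1 : ∫ x in (0:ℝ)..R, (h x + x * deriv h x) = R * h R := by
          rw [intervalIntegral.integral_eq_sub_of_hasDerivAt (f := fun x => x * h x)]
          · simp
          · intro x _
            simpa using (hasDerivAt_id' x).fun_mul (hd x).hasDerivAt
          · apply Continuous.intervalIntegrable
            have := hd.continuous
            have := hd'.continuous
            fun_prop
        have hc1 := hd.continuous
        have hc2 := hd'.continuous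
        rw [← h1, ← intervalIntegral.integral_sub
          (by apply Continuous.intervalIntegrable; fun_prop)
          (by apply Continuous.intervalIntegrable; fun_prop)]
        rw [eq_div_iff (by positivity), ← intervalIntegral.integral_mul_const]
        congr 1
        ext x
        ring
      have hb : Tendsto (fun R => R * h R) atTop (nhds 0) := by
        have hB : Tendsto (fun R : ℝ => (∑ j ∈ s, |c j|) * (R ^ (q + 1))⁻¹) atTop (nhds 0) := by
          have := (tendsto_pow_atTop (α := ℝ) (n := q + 1) (by simp)).inv_tendsto_atTop
          simpa using this.const_mul (∑ j ∈ s, |c j|)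
        refine squeeze_zero_norm' ?_ hB
        filter_upwards [eventually_gt_atTop 0] with R hR
        have : R * h R = (∑ j ∈ s, c j * sin (a j * R + φ)) * (R ^ (q + 1))⁻¹ := by
          rw [hx]
          field_simp
          ring
        rw [this, norm_mul, norm_inv, norm_pow, Real.norm_of_nonneg hR.le]
        gcongr
        refine (norm_sum_le _ _).trans (Finset.sum_le_sum fun j _ => ?_)
        rw [norm_mul]
        simpa using mul_le_mul_of_nonneg_left (abs_sin_le_one (a j * R + φ)) (abs_nonneg (c j))
      simp only [hint]
      convert (key.sub hb).div_const ((q:ℝ) + 1) using 2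
      rw [sub_zero, Nat.factorial_succ]
      have e1 : φ + π / 2 + q * (π / 2) = φ + ((q + 1 : ℕ) : ℝ) * (π / 2) := by
        push_cast; ring
      have e2 : ∑ j ∈ s, c j * a j * a j ^ q * (SignType.sign (a j) : ℝ) =
          ∑ j ∈ s, c j * a j ^ (q + 1) * (SignType.sign (a j) : ℝ) :=
        Finset.sum_congr rfl fun j _ => by ring
      rw [e1, e2]
      have := Nat.factorial_ne_zero q
      push_cast
      field_simp
    · intro x
      have h1 : HasDerivAt (fun x => ∑ j ∈ s, c j * sin (a j * x + φ))
          (∑ j ∈ s, c j * (cos (a j * x + φ) * a j)) x := by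
        apply HasDerivAt.fun_sum
        intro j _
        have := (((hasDerivAt_id x).const_mul (a j)).add_const φ).sin.const_mul (c j)
        simpa using this
      have h2 : HasDerivAt (fun x => x ^ (q + 1 + 1) * h x) _ x :=
        (hasDerivAt_pow (q + 1 + 1) x).mul (hd x).hasDerivAt
      rw [← funext hx] at h2
      have h3 := h1.unique h2
      calc _ = ∑ j ∈ s, c j * (cos (a j * x + φ) * a j) := by
            refine Finset.sum_congr rfl fun j _ => ?_
            rw [← add_assoc, sin_add_pi_div_two]
            ring
        _ = _ := by
            rw [h3]
            simp only [Nat.add_sub_cancel]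
            push_cast
            ring
    · rw [← hφ]
      congr 1
      push_cast; ring

lemma aux_sin_pow (n : ℕ) (x : ℝ) :
    ∑ k ∈ range (n + 1), ((-1) ^ k * (n.choose k : ℝ) / 2 ^ n) *
      sin (((n : ℝ) - 2 * k) * x + (1 - n) * (π / 2)) = sin x ^ n := by
  have hI : ∀ k ∈ range (n + 1), (((-1) ^ k * (n.choose k : ℝ) / 2 ^ n) *
      sin (((n : ℝ) - 2 * k) * x + (1 - n) * (π / 2))) =
      ((-Complex.exp (-(x * Complex.I)) ) ^ k * (Complex.exp (x * Complex.I)) ^ (n - k) *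
        (n.choose k) * (-Complex.I / 2) ^ n).re := by
    intro k hk
    have hk : k ≤ n := by simpa [Nat.lt_succ_iff] using hk
    have h1 : sin (((n : ℝ) - 2 * k) * x + (1 - n) * (π / 2)) =
        cos (((n : ℝ) - 2 * k) * x - n * (π / 2)) := by
      rw [← sin_add_pi_div_two]; congr 1; ring
    have h2 : -Complex.I = Complex.exp (-(π / 2) * Complex.I) := by
      rw [neg_mul, Complex.exp_neg, Complex.exp_pi_div_two_mul_I, Complex.inv_I]
    have h3 : (-Complex.exp (-(x * Complex.I)) ) ^ k * (Complex.exp (x * Complex.I)) ^ (n - k) *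
        (n.choose k) * (-Complex.I / 2) ^ n =
        (((-1) ^ k * (n.choose k : ℝ) / 2 ^ n : ℝ) : ℂ) *
          Complex.exp (((((n : ℝ) - 2 * k) * x - n * (π / 2) : ℝ) : ℂ) * Complex.I) := by
      have h4 : Complex.exp (((((n : ℝ) - 2 * k) * x - n * (π / 2) : ℝ) : ℂ) * Complex.I) =
          Complex.exp (-(x * Complex.I)) ^ k * (Complex.exp (x * Complex.I)) ^ (n - k) *
          Complex.exp (-(π / 2) * Complex.I) ^ n := by
        rw [← Complex.exp_nat_mul, ← Complex.exp_nat_mul, ← Complex.exp_nat_mul,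
          ← Complex.exp_add, ← Complex.exp_add]
        congr 1
        push_cast [hk]
        ring
      rw [h4, ← h2, neg_pow, div_pow]
      push_cast
      ring
    rw [h3, Complex.re_ofReal_mul, Complex.exp_ofReal_mul_I_re, h1]
  rw [Finset.sum_congr rfl hI, ← Complex.re_sum, ← Finset.sum_mul, ← add_pow, ← mul_pow]
  have : (-Complex.exp (-(x * Complex.I)) + Complex.exp (x * Complex.I)) * (-Complex.I / 2) =
      ((sin x : ℝ) : ℂ) := by
    rw [Complex.ofReal_sin, Complex.sin, neg_mul]
    ring
  rw [this, ← Complex.ofReal_pow, Complex.ofReal_re]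

lemma aux_fold (n q : ℕ) (hq : 1 ≤ q) (hnq : q ≤ n) (heven : Even (n + q)) :
    ∑ k ∈ range (n + 1), (-1 : ℝ) ^ k * (n.choose k : ℝ) * ((n : ℝ) - 2 * k) ^ (q - 1) *
      (SignType.sign ((n : ℝ) - 2 * k) : ℝ) =
    2 * ∑ k ∈ range ((n - 1) / 2 + 1),
          (-1 : ℝ) ^ k * (n.choose k : ℝ) * ((n : ℝ) - 2 * k) ^ (q - 1) := by
  set m := (n - 1) / 2 + 1 with hm
  set f : ℕ → ℝ := fun k => (-1 : ℝ) ^ k * (n.choose k : ℝ) * ((n : ℝ) - 2 * k) ^ (q - 1) *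
      (SignType.sign ((n : ℝ) - 2 * k) : ℝ) with hf
  have hpos : ∑ k ∈ range m, f k = ∑ k ∈ range m,
      (-1 : ℝ) ^ k * (n.choose k : ℝ) * ((n : ℝ) - 2 * k) ^ (q - 1) := by
    refine Finset.sum_congr rfl fun k hk => ?_
    have hk : 2 * k < n := by have := Finset.mem_range.1 hk; omega
    have : (0:ℝ) < (n : ℝ) - 2 * k := by
      have : (2 * k : ℝ) < n := by exact_mod_cast hk
      linarith
    simp [hf, sign_pos this]
  have hsymm : ∀ k, k ≤ n → f (n - k) = f k := by
    intro k hk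
    simp only [hf]
    rw [Nat.choose_symm hk, Nat.cast_sub hk]
    have e : (n : ℝ) - 2 * ((n:ℝ) - k) = -((n:ℝ) - 2 * k) := by ring
    rw [e, Left.sign_neg, neg_pow ((n:ℝ) - 2 * k)]
    have e2 : (-1 : ℝ) ^ (n - k) * (-1) ^ (q - 1) * (-1) = (-1) ^ k := by
      rw [← pow_add, ← pow_succ]
      rcases Nat.even_or_odd k with h | h
      · rw [h.neg_one_pow, Even.neg_one_pow]
        rw [Nat.even_iff] at *; omega
      · rw [h.neg_one_pow, Odd.neg_one_pow]
        rw [Nat.even_iff] at *; rw [Nat.odd_iff] at *; omega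
    rw [← e2]
    push_cast
    ring
  have hsplit : ∑ k ∈ range (n + 1), f k = ∑ k ∈ range m, f k + ∑ k ∈ range (n + 1 - m), f (m + k) := by
    rw [← Finset.sum_range_add]
    congr 2; omega
  have hrefl : ∑ k ∈ range (n + 1 - m), f (m + k) = ∑ k ∈ range (n + 1 - m), f k := by
    rw [← Finset.sum_range_reflect]
    refine Finset.sum_congr rfl fun k hk => ?_
    have hk := Finset.mem_range.1 hk
    rw [← hsymm k (by omega)]
    congr 1; omega
  have hlast : ∑ k ∈ range (n + 1 - m), f k = ∑ k ∈ range m, f k := by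
    rcases Nat.even_or_odd n with h | h
    · have : n + 1 - m = m + 1 := by rw [Nat.even_iff] at h; omega
      rw [this, Finset.sum_range_succ]
      have h0 : (n : ℝ) - 2 * m = 0 := by
        have : n = 2 * m := by rw [Nat.even_iff] at h; omega
        rw [sub_eq_zero]
        exact_mod_cast this
      simp [hf, h0]
    · have : n + 1 - m = m := by rw [Nat.odd_iff] at h; omega
      rw [this]
  rw [hsplit, hrefl, hlast, hpos]
  ring

theorem integral_sin_pow_div_pow_even (n q : ℕ) (hq : 1 ≤ q) (hnq : q ≤ n)
    (heven : Even (n + q)) :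
    Tendsto (fun R : ℝ => ∫ x in (0:ℝ)..R, Real.sin x ^ n / x ^ q) atTop
      (nhds ((-1 : ℝ) ^ (((q : ℤ) - n) / 2) * Real.pi / (2 ^ n * ((q - 1).factorial : ℝ)) *
        ∑ k ∈ Finset.range ((n - 1) / 2 + 1),
          (-1 : ℝ) ^ k * (n.choose k : ℝ) * ((n : ℝ) - 2 * k) ^ (q - 1))) := by
  have hs : ∀ x, sin x = x * sinc x := by
    intro x
    by_cases hx : x = 0
    · simp [hx]
    · rw [sinc_of_ne_zero hx]; field_simp
  obtain ⟨r, hr⟩ : ∃ r : ℤ, (q : ℤ) - n = 2 * r := by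
    obtain ⟨r, hr⟩ := heven
    exact ⟨q - r, by omega⟩
  have hr' : (q : ℝ) - n = 2 * r := by exact_mod_cast hr
  have hφ : (1 - (n:ℝ)) * (π / 2) + ((q - 1 : ℕ) : ℝ) * (π / 2) = r * π := by
    rw [Nat.cast_sub hq]
    linear_combination (π / 2) * hr'
  have hsc : ContDiff ℝ ((⊤ : ℕ∞) : WithTop ℕ∞) sinc := aux_contDiff_sinc.of_le le_top
  have key := aux_key (range (n + 1)) (fun k => (n : ℝ) - 2 * k) (q - 1)
    (fun k => (-1) ^ k * (n.choose k : ℝ) / 2 ^ n) ((1 - n) * (π / 2))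
    (fun x => sinc x ^ q * sin x ^ (n - q))
    ((hsc.pow q).mul (Real.contDiff_sin.pow _)) ?_ ?_
  · rw [hφ, cos_int_mul_pi] at key
    have hr2 : ((q : ℤ) - n) / 2 = r := by omega
    rw [hr2]
    have h2 : (fun R => ∫ x in (0:ℝ)..R, sinc x ^ q * sin x ^ (n - q))
        =ᶠ[atTop] fun R : ℝ => ∫ x in (0:ℝ)..R, Real.sin x ^ n / x ^ q := by
      filter_upwards [eventually_gt_atTop 0] with R hR
      rw [intervalIntegral.integral_of_le hR.le, intervalIntegral.integral_of_le hR.le]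
      apply MeasureTheory.setIntegral_congr_fun measurableSet_Ioc
      intro x hx
      simp only
      rw [sinc_of_ne_zero hx.1.ne', div_pow, div_mul_eq_mul_div, ← pow_add,
        Nat.add_sub_cancel' hnq]
    refine Tendsto.congr' h2 ?_
    convert key using 2
    have hfold := aux_fold n q hq hnq heven
    have : ∑ k ∈ range (n + 1), (-1 : ℝ) ^ k * (n.choose k : ℝ) / 2 ^ n *
        ((n : ℝ) - 2 * k) ^ (q - 1) * (SignType.sign ((n : ℝ) - 2 * k) : ℝ) =
        (∑ k ∈ range (n + 1), (-1 : ℝ) ^ k * (n.choose k : ℝ) * ((n : ℝ) - 2 * k) ^ (q - 1) *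
      (SignType.sign ((n : ℝ) - 2 * k) : ℝ)) / 2 ^ n := by
      rw [Finset.sum_div]
      exact Finset.sum_congr rfl fun k _ => by ring
    rw [this, hfold]
    have := Nat.factorial_ne_zero (q - 1)
    field_simp
  · intro x
    rw [aux_sin_pow, Nat.sub_add_cancel hq, ← mul_assoc, ← mul_pow, ← hs, ← pow_add,
      Nat.add_sub_cancel' hnq]
  · rw [hφ, sin_int_mul_pi]
end

section
/- Let n ≥ q ≥ 2 be integers with n + q odd. Then ∫_0^∞ sin(x)^n / x^q dx = ((−1)^{(q−n+1)/2} / (2^{n−1} (q−1)!)) · Σ_{k=0}^{⌊(n−1)/2⌋} (−1)^k C(n,k) (n−2k)^{q−1} log(n−2k). -/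
open Filter Finset Real

lemma aux_cos_cont (a x : ℝ) :
    (1 - Real.cos (a * x)) / x = a * (Real.sin (a * x / 2) * Real.sinc (a * x / 2)) := by
  by_cases hx : x = 0
  · subst hx; simp
  by_cases ha : a = 0
  · subst ha; simp
  have h : a * x / 2 ≠ 0 := by positivity
  rw [Real.sinc_of_ne_zero h]
  have h2 : Real.cos (a * x) = 1 - 2 * Real.sin (a * x / 2) ^ 2 := by
    have := Real.cos_sq_add_sin_sq (a * x / 2)
    have h3 : Real.cos (a * x) = Real.cos (2 * (a * x / 2)) := by congr 1; ring
    rw [h3, Real.cos_two_mul]; linarith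
  rw [h2]; field_simp; ring

lemma aux_cos_int (a u v : ℝ) :
    IntervalIntegrable (fun x => (1 - Real.cos (a * x)) / x) MeasureTheory.volume u v := by
  have : (fun x => (1 - Real.cos (a * x)) / x) =
      fun x => a * (Real.sin (a * x / 2) * Real.sinc (a * x / 2)) := by
    funext x; exact aux_cos_cont a x
  rw [this]
  apply Continuous.intervalIntegrable
  have := Real.continuous_sinc
  fun_prop

lemma aux_cos_tail (a : ℝ) (ha : 1 ≤ a) (R : ℝ) (hR : 0 < R) :
    |∫ x in R..(a * R), Real.cos x / x| ≤ (a + 1) / R := by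
  have hle : R ≤ a * R := by nlinarith
  have hpos : ∀ x ∈ Set.uIcc R (a * R), 0 < x := by
    intro x hx; rw [Set.uIcc_of_le hle] at hx; linarith [hx.1]
  have hc1 : ContinuousOn (fun x : ℝ => Real.cos x / x) (Set.uIcc R (a * R)) :=
    Real.continuous_cos.continuousOn.div continuousOn_id (fun x hx => (hpos x hx).ne')
  have hc2 : ContinuousOn (fun x : ℝ => Real.sin x / x ^ 2) (Set.uIcc R (a * R)) :=
    Real.continuous_sin.continuousOn.div (continuousOn_id.pow 2)
      (fun x hx => (pow_pos (hpos x hx) 2).ne')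
  have hftc : ∫ x in R..(a * R), (Real.cos x / x - Real.sin x / x ^ 2) =
      Real.sin (a * R) / (a * R) - Real.sin R / R := by
    apply intervalIntegral.integral_eq_sub_of_hasDerivAt (f := fun x => Real.sin x / x)
    · intro x hx
      have h0 := (hpos x hx).ne'
      refine ((Real.hasDerivAt_sin x).fun_div (hasDerivAt_id' x) h0).congr_deriv ?_
      field_simp
    · exact (hc1.sub hc2).intervalIntegrable
  rw [intervalIntegral.integral_sub hc1.intervalIntegrable hc2.intervalIntegrable] at hftc
  have hb : ‖∫ x in R..(a * R), Real.sin x / x ^ 2‖ ≤ (1 / R ^ 2) * |a * R - R| := by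
    apply intervalIntegral.norm_integral_le_of_norm_le_const
    intro x hx
    rw [Set.uIoc_of_le hle] at hx
    have hx0 : 0 < x := by linarith [hx.1]
    rw [norm_div, Real.norm_eq_abs, norm_pow, Real.norm_eq_abs, abs_of_pos hx0]
    have := hx.1.le
    gcongr
    exact Real.abs_sin_le_one x
  rw [Real.norm_eq_abs, abs_of_nonneg (by linarith : 0 ≤ a * R - R)] at hb
  have e : (1 / R ^ 2) * (a * R - R) = (a - 1) / R := by field_simp
  rw [e] at hb
  have h1 : |Real.sin (a * R) / (a * R)| ≤ 1 / R := by
    rw [abs_div, abs_of_pos (by nlinarith : 0 < a * R)]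
    gcongr
    exact Real.abs_sin_le_one _
  have h2 : |Real.sin R / R| ≤ 1 / R := by
    rw [abs_div, abs_of_pos hR]
    gcongr
    exact Real.abs_sin_le_one _
  have h3 : (a + 1) / R = (a - 1) / R + 1 / R + 1 / R := by field_simp; ring
  rw [h3]
  rw [abs_le] at *
  constructor <;> linarith [hb.1, hb.2, h1.1, h1.2, h2.1, h2.2]

lemma aux_frullani (a : ℝ) (ha : 1 ≤ a) :
    Tendsto (fun R : ℝ => (∫ x in (0:ℝ)..R, (1 - Real.cos (a * x)) / x)
      - ∫ x in (0:ℝ)..R, (1 - Real.cos x) / x) atTop (nhds (Real.log a)) := by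
  have key : ∀ R : ℝ, 0 < R → (∫ x in (0:ℝ)..R, (1 - Real.cos (a * x)) / x)
      - ∫ x in (0:ℝ)..R, (1 - Real.cos x) / x =
      Real.log a - ∫ x in R..(a * R), Real.cos x / x := by
    intro R hR
    have ha0 : a ≠ 0 := by linarith
    have hle : R ≤ a * R := by nlinarith
    have hpos : ∀ x ∈ Set.uIcc R (a * R), 0 < x := by
      intro x hx; rw [Set.uIcc_of_le hle] at hx; linarith [hx.1]
    have hc1 : ContinuousOn (fun x : ℝ => Real.cos x / x) (Set.uIcc R (a * R)) :=
      Real.continuous_cos.continuousOn.div continuousOn_id (fun x hx => (hpos x hx).ne')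
    have hc2 : ContinuousOn (fun x : ℝ => 1 / x) (Set.uIcc R (a * R)) :=
      continuousOn_const.div continuousOn_id (fun x hx => (hpos x hx).ne')
    have hint : ∀ u v, IntervalIntegrable (fun x => (1 - Real.cos x) / x)
        MeasureTheory.volume u v := by
      intro u v; simpa using aux_cos_int 1 u v
    have hs := intervalIntegral.integral_comp_mul_left (a := 0) (b := R)
      (fun t => (1 - Real.cos t) / t) ha0
    have hs' : (∫ x in (0:ℝ)..R, (1 - Real.cos (a * x)) / x) =
        ∫ x in (0:ℝ)..(a * R), (1 - Real.cos x) / x := by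
      have : (∫ x in (0:ℝ)..R, (1 - Real.cos (a * x)) / x) =
          a * ∫ x in (0:ℝ)..R, (1 - Real.cos (a * x)) / (a * x) := by
        rw [← intervalIntegral.integral_const_mul]
        congr 1; funext x
        by_cases hx : x = 0
        · simp [hx]
        · field_simp
      rw [this, hs]; simp [ha0]
    rw [hs', intervalIntegral.integral_interval_sub_left (hint _ _) (hint _ _)]
    have : ∀ x : ℝ, (1 - Real.cos x) / x = 1 / x - Real.cos x / x := fun x => sub_div _ _ _
    simp_rw [this]
    rw [intervalIntegral.integral_sub hc2.intervalIntegrable hc1.intervalIntegrable,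
      integral_one_div_of_pos hR (by linarith)]
    congr 2; field_simp
  have hz : Tendsto (fun R : ℝ => ∫ x in R..(a * R), Real.cos x / x) atTop (nhds 0) := by
    apply squeeze_zero_norm' (a := fun R => (a + 1) / R)
    · filter_upwards [eventually_gt_atTop 0] with R hR using aux_cos_tail a ha R hR
    · exact tendsto_const_nhds.div_atTop tendsto_id
  have := (tendsto_const_nhds (x := Real.log a)).sub hz
  rw [sub_zero] at this
  refine this.congr' ?_
  filter_upwards [eventually_gt_atTop 0] with R hR using (key R hR).symm

lemma aux_frullani_sum {ι : Type} (s : Finset ι) (d : ι → ℝ) (a : ι → ℝ)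
    (ha : ∀ k ∈ s, d k = 0 ∨ 1 ≤ |a k|) (hd : ∑ k ∈ s, d k = 0) :
    Tendsto (fun R : ℝ => ∫ x in (0:ℝ)..R, (∑ k ∈ s, d k * Real.cos (a k * x)) / x) atTop
      (nhds (-∑ k ∈ s, d k * Real.log (a k))) := by
  have e : ∀ R : ℝ, ∫ x in (0:ℝ)..R, (∑ k ∈ s, d k * Real.cos (a k * x)) / x =
      -∑ k ∈ s, d k * ((∫ x in (0:ℝ)..R, (1 - Real.cos (a k * x)) / x)
      - ∫ x in (0:ℝ)..R, (1 - Real.cos x) / x) := by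
    intro R
    have e1 : ∀ x : ℝ, (∑ k ∈ s, d k * Real.cos (a k * x)) / x =
        -∑ k ∈ s, d k * ((1 - Real.cos (a k * x)) / x) := by
      intro x
      have : ∑ k ∈ s, d k * ((1 - Real.cos (a k * x)) / x) =
          (∑ k ∈ s, d k) / x - (∑ k ∈ s, d k * Real.cos (a k * x)) / x := by
        rw [Finset.sum_div, Finset.sum_div, ← Finset.sum_sub_distrib]
        apply Finset.sum_congr rfl; intros; ring
      rw [this, hd]; simp
    simp_rw [e1]
    rw [intervalIntegral.integral_neg, intervalIntegral.integral_finsetSum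
      (fun k _ => (aux_cos_int (a k) 0 R).const_mul (d k))]
    simp_rw [intervalIntegral.integral_const_mul, mul_sub]
    rw [Finset.sum_sub_distrib, ← Finset.sum_mul, hd]; simp
  simp_rw [e]
  apply Tendsto.neg
  apply tendsto_finsetSum
  intro k hk
  rcases ha k hk with h | h
  · simp [h]
  · apply Tendsto.const_mul
    have := aux_frullani |a k| h
    rw [Real.log_abs] at this
    refine this.congr ?_
    intro R
    congr 2
    funext x
    congr 2
    rcases abs_choice (a k) with h | h <;> rw [h]
    rw [neg_mul, Real.cos_neg]

lemma aux_ibp (m : ℕ) : ∀ (f : ℕ → ℝ → ℝ) (L : ℝ)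
    (_ : ∀ j x, HasDerivAt (f j) (f (j + 1) x) x)
    (_ : ∀ j, ∃ C, ∀ x, |f j x| ≤ C)
    (_ : ∀ j ≤ m, ∃ h : ℝ → ℝ, Continuous h ∧ ∀ x, f j x = x ^ (m + 1 - j) * h x)
    (_ : Tendsto (fun R : ℝ => ∫ x in (0:ℝ)..R, f m x / x) atTop (nhds L)),
    Tendsto (fun R : ℝ => ∫ x in (0:ℝ)..R, f 0 x / x ^ (m + 1)) atTop
      (nhds (L / (m.factorial : ℝ))) := by
  induction m with
  | zero => intro f L _ _ _ hL; simpa using hL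
  | succ m ih =>
    intro f L hd hb hz hL
    have ih' := ih (fun j => f (j + 1)) L (fun j => hd (j + 1)) (fun j => hb (j + 1))
      (fun j hj => by
        obtain ⟨h, hc, hh⟩ := hz (j + 1) (by omega)
        refine ⟨h, hc, fun x => ?_⟩
        rw [hh x]; congr 2; omega) hL
    simp only [zero_add] at ih'
    obtain ⟨h0, hc0, hh0⟩ := hz 0 (by omega)
    obtain ⟨h1, hc1, hh1⟩ := hz 1 (by omega)
    obtain ⟨C, hC⟩ := hb 0
    have hint : ∀ (N : ℕ) (g h : ℝ → ℝ) (R : ℝ), Continuous h → (∀ x, g x = x ^ N * h x) →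
        0 ≤ R → IntervalIntegrable (fun x => g x / x ^ N) MeasureTheory.volume 0 R := by
      intro N g h R hc hg hR
      apply (hc.intervalIntegrable 0 R).congr
      intro x hx
      rw [Set.uIoc_of_le hR] at hx
      have : x ≠ 0 := hx.1.ne'
      simp only [hg x]
      field_simp
    have key : ∀ R : ℝ, 0 < R → ∫ x in (0:ℝ)..R, f 0 x / x ^ (m + 1 + 1) =
        (1 / ((m : ℝ) + 1)) * (∫ x in (0:ℝ)..R, f 1 x / x ^ (m + 1))
          - (1 / ((m : ℝ) + 1)) * (f 0 R / R ^ (m + 1)) := by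
      intro R hR
      have i0 := hint (m + 1 + 1) (f 0) h0 R hc0 (by simpa using hh0) hR.le
      have i1 := hint (m + 1) (f 1) h1 R hc1 (by simpa using hh1) hR.le
      have hm : (m : ℝ) + 1 ≠ 0 := by positivity
      have hftc : ∫ x in (0:ℝ)..R, (f 1 x / x ^ (m + 1)
          - ((m : ℝ) + 1) * (f 0 x / x ^ (m + 1 + 1))) =
          f 0 R / R ^ (m + 1) - f 0 0 / 0 ^ (m + 1) := by
        apply intervalIntegral.integral_eq_sub_of_hasDerivAt_of_le hR.le
          (f := fun x => f 0 x / x ^ (m + 1))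
        · have : (fun x => f 0 x / x ^ (m + 1)) = fun x => x * h0 x := by
            funext x
            rw [hh0 x]
            by_cases hx : x = 0
            · simp [hx]
            · rw [Nat.sub_zero, pow_succ x (m + 1)]; field_simp
          rw [this]
          fun_prop
        · intro x hx
          have hx0 : x ≠ 0 := hx.1.ne'
          refine ((hd 0 x).fun_div (hasDerivAt_pow (m + 1) x)
            (pow_ne_zero _ hx0)).congr_deriv ?_
          push_cast
          field_simp
          ring
        · exact i1.sub (i0.const_mul _)
      rw [intervalIntegral.integral_sub i1 (i0.const_mul _),
        intervalIntegral.integral_const_mul] at hftc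
      simp only [ne_eq, Nat.add_eq_zero_iff, one_ne_zero, and_false, not_false_eq_true,
        zero_pow, div_zero, sub_zero] at hftc
      rw [← hftc]; field_simp; ring
    have hz0 : Tendsto (fun R : ℝ => f 0 R / R ^ (m + 1)) atTop (nhds 0) := by
      apply squeeze_zero_norm' (a := fun R => C / R ^ (m + 1))
      · filter_upwards [eventually_gt_atTop 0] with R hR
        rw [norm_div, Real.norm_eq_abs, Real.norm_eq_abs, abs_of_pos (pow_pos hR (m + 1))]
        have := hC R
        gcongr
      · exact tendsto_const_nhds.div_atTop (tendsto_pow_atTop (by omega))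
    have := (ih'.const_mul (1 / ((m : ℝ) + 1))).sub (hz0.const_mul (1 / ((m : ℝ) + 1)))
    have e : (1 / ((m : ℝ) + 1)) * (L / (m.factorial : ℝ)) - (1 / ((m : ℝ) + 1)) * 0
        = L / ((m + 1).factorial : ℝ) := by
      rw [Nat.factorial_succ]; push_cast; field_simp; ring
    rw [e] at this
    refine this.congr' ?_
    filter_upwards [eventually_gt_atTop 0] with R hR using (key R hR).symm

/-- The iterated derivatives of `sin ^ n`. -/
noncomputable def auxF (n j : ℕ) (x : ℝ) : ℝ :=
  ∑ k ∈ Finset.range (n + 1), ((-1 : ℝ) ^ k * (n.choose k : ℝ) / 2 ^ n) * ((n : ℝ) - 2 * k) ^ j *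
    Real.cos (((n : ℝ) - 2 * k) * x + ((j : ℝ) - n) * (π / 2))

lemma auxF_zero (n : ℕ) (x : ℝ) : auxF n 0 x = Real.sin x ^ n := by
  have hc : ((Real.sin x : ℝ) : ℂ) ^ n = ∑ k ∈ Finset.range (n + 1),
      (((-1 : ℝ) ^ k * (n.choose k : ℝ) / 2 ^ n : ℝ) : ℂ) *
      Complex.exp (((((n : ℝ) - 2 * k) * x + (((0 : ℕ) : ℝ) - n) * (π / 2) : ℝ) : ℂ) * Complex.I) := by
    have h1 : ((Real.sin x : ℝ) : ℂ) = (-Complex.exp (-x * Complex.I) + Complex.exp (x * Complex.I))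
        * (-Complex.I / 2) := by
      rw [Complex.ofReal_sin, Complex.sin]; ring
    rw [h1, mul_pow, add_pow, Finset.sum_mul]
    apply Finset.sum_congr rfl
    intro k hk
    have hk' : k ≤ n := by simpa [Nat.lt_succ_iff] using hk
    have h2 : (-Complex.I / 2) ^ n = Complex.exp (-(n * (π / 2)) * Complex.I) / 2 ^ n := by
      rw [div_pow]
      congr 1
      have : -Complex.I = Complex.exp (-(π / 2 * Complex.I)) := by
        rw [Complex.exp_neg, Complex.exp_pi_div_two_mul_I, Complex.inv_I]
      rw [this, ← Complex.exp_nat_mul]; congr 1; ring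
    rw [h2, neg_pow, ← Complex.exp_nat_mul, ← Complex.exp_nat_mul]
    push_cast [Nat.cast_sub hk']
    have h3 : Complex.exp (((n - 2 * k) * x + (0 - n) * (π / 2)) * Complex.I) =
        Complex.exp (k * (-x * Complex.I)) * Complex.exp ((n - k) * (x * Complex.I)) *
        Complex.exp (-(n * (π / 2)) * Complex.I) := by
      rw [← Complex.exp_add, ← Complex.exp_add]; congr 1; ring
    rw [h3]; ring
  have := congrArg Complex.re hc
  rw [← Complex.ofReal_pow, Complex.ofReal_re, Complex.re_sum] at this
  rw [this, auxF]
  apply Finset.sum_congr rfl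
  intro k _
  rw [Complex.re_ofReal_mul, Complex.exp_ofReal_mul_I_re, pow_zero, mul_one]

lemma auxF_deriv (n j : ℕ) (x : ℝ) : HasDerivAt (auxF n j) (auxF n (j + 1) x) x := by
  unfold auxF
  apply HasDerivAt.fun_sum
  intro k _
  have h := ((((hasDerivAt_id' x).const_mul ((n : ℝ) - 2 * k)).add_const
    (((j : ℝ) - n) * (π / 2))).cos).const_mul
    (((-1 : ℝ) ^ k * (n.choose k : ℝ) / 2 ^ n) * ((n : ℝ) - 2 * k) ^ j)
  refine h.congr_deriv ?_
  have : ((n : ℝ) - 2 * k) * x + (((j + 1 : ℕ) : ℝ) - n) * (π / 2) =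
      (((n : ℝ) - 2 * k) * x + ((j : ℝ) - n) * (π / 2)) + π / 2 := by push_cast; ring
  rw [this, Real.cos_add_pi_div_two]
  ring

lemma auxF_bdd (n j : ℕ) : ∃ C, ∀ x, |auxF n j x| ≤ C := by
  refine ⟨∑ k ∈ Finset.range (n + 1),
    |((-1 : ℝ) ^ k * (n.choose k : ℝ) / 2 ^ n) * ((n : ℝ) - 2 * k) ^ j|, fun x => ?_⟩
  refine (Finset.abs_sum_le_sum_abs _ _).trans (Finset.sum_le_sum fun k _ => ?_)
  rw [abs_mul]
  exact mul_le_of_le_one_right (abs_nonneg _) (Real.abs_cos_le_one _)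

lemma auxF_smooth (n j : ℕ) (hj : j ≤ n) : ∃ h : ℝ → ℝ, ContDiff ℝ (⊤ : ℕ∞) h ∧
    ∀ x, auxF n j x = Real.sin x ^ (n - j) * h x := by
  induction j with
  | zero => exact ⟨fun _ => 1, contDiff_const, fun x => by simp [auxF_zero]⟩
  | succ j ih =>
    obtain ⟨h, hc, hh⟩ := ih (by omega)
    have hdc : ContDiff ℝ (⊤ : ℕ∞) (deriv h) := (contDiff_infty_iff_deriv.1 hc).2
    have hcos := Real.contDiff_cos (n := (⊤ : ℕ∞))
    have hsin := Real.contDiff_sin (n := (⊤ : ℕ∞))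
    refine ⟨fun x => ((n - j : ℕ) : ℝ) * Real.cos x * h x + Real.sin x * deriv h x,
      ((contDiff_const.mul hcos).mul hc).add (hsin.mul hdc), fun x => ?_⟩
    have e : auxF n j = fun x => Real.sin x ^ (n - j) * h x := funext hh
    have h1 := auxF_deriv n j x
    rw [e] at h1
    have h2 := ((Real.hasDerivAt_sin x).fun_pow (n - j)).fun_mul
      ((contDiff_infty_iff_deriv.1 hc).1 x).hasDerivAt
    rw [h1.unique h2]
    obtain ⟨p, hp⟩ : ∃ p, n - j = p + 1 := ⟨n - j - 1, by omega⟩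
    have hp' : n - (j + 1) = p := by omega
    rw [hp, hp']
    simp only [Nat.add_sub_cancel]; ring

lemma aux_sin_sinc (x : ℝ) : Real.sin x = x * Real.sinc x := by
  by_cases hx : x = 0
  · simp [hx]
  · rw [Real.sinc_of_ne_zero hx]; field_simp

lemma aux_cos_parity (n q : ℕ) (hq : 2 ≤ q) (hodd : Odd (n + q)) (y : ℝ) :
    Real.cos (y + (((q - 1 : ℕ) : ℝ) - n) * (π / 2)) =
      -(-1 : ℝ) ^ (((q : ℤ) - n + 1) / 2) * Real.cos y := by
  obtain ⟨t, ht⟩ : ∃ t : ℤ, (q : ℤ) - n + 1 = 2 * t := by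
    obtain ⟨r, hr⟩ := hodd
    exact ⟨r + 1 - n, by omega⟩
  have h1 : (((q - 1 : ℕ) : ℝ) - n) = 2 * ((t - 1 : ℤ) : ℝ) := by
    rw [Nat.cast_sub (by omega)]
    have : (q : ℝ) - n + 1 = 2 * t := by exact_mod_cast ht
    push_cast; linarith
  rw [ht, h1, Int.mul_ediv_cancel_left _ (by norm_num)]
  have h2 : y + 2 * ((t - 1 : ℤ) : ℝ) * (π / 2) = y + ((t - 1 : ℤ) : ℝ) * π := by ring
  rw [h2, Real.cos_add_int_mul_pi, zpow_sub_one₀ (by norm_num)]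
  norm_num

lemma aux_half_sum (n : ℕ) (hn : 1 ≤ n) (g : ℕ → ℝ) (hs : ∀ k ≤ n, g (n - k) = g k)
    (hmid : ∀ k, 2 * k = n → g k = 0) :
    ∑ k ∈ Finset.range (n + 1), g k = 2 * ∑ k ∈ Finset.range ((n - 1) / 2 + 1), g k := by
  have hr := Finset.sum_range_reflect g (n + 1)
  have hA : ∑ k ∈ Finset.range (n + 1), g k =
      ∑ k ∈ (Finset.range (n + 1)).filter (fun k => 2 * k < n), g k +
      ∑ k ∈ (Finset.range (n + 1)).filter (fun k => ¬ 2 * k < n), g k :=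
    (Finset.sum_filter_add_sum_filter_not _ _ _).symm
  have hB : (Finset.range (n + 1)).filter (fun k => 2 * k < n) =
      Finset.range ((n - 1) / 2 + 1) := by
    ext k; simp only [Finset.mem_filter, Finset.mem_range]; omega
  have hC : ∑ k ∈ (Finset.range (n + 1)).filter (fun k => ¬ 2 * k < n), g k =
      ∑ k ∈ (Finset.range (n + 1)).filter (fun k => n < 2 * k), g k := by
    symm
    apply Finset.sum_subset
    · intro k; simp only [Finset.mem_filter, Finset.mem_range]; omega
    · intro k hk hk'
      simp only [Finset.mem_filter, Finset.mem_range] at hk hk'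
      exact hmid k (by omega)
  have hD : ∑ k ∈ (Finset.range (n + 1)).filter (fun k => n < 2 * k), g k =
      ∑ k ∈ (Finset.range (n + 1)).filter (fun k => 2 * k < n), g k := by
    apply Finset.sum_nbij' (fun k => n - k) (fun k => n - k)
    · intro k; simp only [Finset.mem_filter, Finset.mem_range]; omega
    · intro k; simp only [Finset.mem_filter, Finset.mem_range]; omega
    · intro k; simp only [Finset.mem_filter, Finset.mem_range]; omega
    · intro k; simp only [Finset.mem_filter, Finset.mem_range]; omega
    · intro k hk
      simp only [Finset.mem_filter, Finset.mem_range] at hk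
      exact (hs k (by omega)).symm
  rw [hA, hC, hD, hB]; ring

/-- Main theorem, case `n + q` odd, `q ≥ 2`: `∫_0^∞ sin(x)^n/x^q dx` equals
`(-1)^{(q-n+1)/2} / (2^{n-1} (q-1)!) ∑_{k=0}^{⌊(n-1)/2⌋} (-1)^k C(n,k) (n-2k)^{q-1} log(n-2k)`. -/
theorem integral_sin_pow_div_pow_odd (n q : ℕ) (hq : 2 ≤ q) (hnq : q ≤ n)
    (hodd : Odd (n + q)) :
    Tendsto (fun R : ℝ => ∫ x in (0:ℝ)..R, Real.sin x ^ n / x ^ q) atTop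
      (nhds ((-1 : ℝ) ^ (((q : ℤ) - n + 1) / 2) / (2 ^ (n - 1) * ((q - 1).factorial : ℝ)) *
        ∑ k ∈ Finset.range ((n - 1) / 2 + 1),
          (-1 : ℝ) ^ k * (n.choose k : ℝ) * ((n : ℝ) - 2 * k) ^ (q - 1) *
            Real.log ((n : ℝ) - 2 * k))) := by
  set σ : ℝ := (-1 : ℝ) ^ (((q : ℤ) - n + 1) / 2) with hσ
  set d : ℕ → ℝ := fun k => (-σ) * (((-1 : ℝ) ^ k * (n.choose k : ℝ) / 2 ^ n) *
    ((n : ℝ) - 2 * k) ^ (q - 1)) with hd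
  have hF : ∀ x, auxF n (q - 1) x =
      ∑ k ∈ Finset.range (n + 1), d k * Real.cos (((n : ℝ) - 2 * k) * x) := by
    intro x
    rw [auxF]
    apply Finset.sum_congr rfl
    intro k _
    rw [aux_cos_parity n q hq hodd]
    simp only [hd, hσ]; ring
  have hd0 : ∑ k ∈ Finset.range (n + 1), d k = 0 := by
    obtain ⟨h, _, hh⟩ := auxF_smooth n (q - 1) (by omega)
    have h1 := hF 0
    rw [hh 0, Real.sin_zero, zero_pow (by omega)] at h1
    simpa using h1.symm
  have hL := aux_frullani_sum (Finset.range (n + 1)) d (fun k => (n : ℝ) - 2 * k)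
    (by
      intro k _
      by_cases hk : (n : ℤ) - 2 * k = 0
      · left
        have : (n : ℝ) - 2 * k = 0 := by exact_mod_cast hk
        simp only [hd, this]
        rw [zero_pow (by omega)]; simp
      · right
        have := Int.one_le_abs hk
        exact_mod_cast this) hd0
  simp_rw [← hF] at hL
  have hmain := aux_ibp (q - 1) (auxF n) _ (auxF_deriv n) (auxF_bdd n)
    (by
      intro j hj
      obtain ⟨h, hc, hh⟩ := auxF_smooth n j (by omega)
      refine ⟨fun x => Real.sinc x ^ (q - 1 + 1 - j) * (Real.sin x ^ (n - q) * h x), ?_, ?_⟩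
      · have := hc.continuous
        have := Real.continuous_sinc
        fun_prop
      · intro x
        have e : n - j = (q - 1 + 1 - j) + (n - q) := by omega
        rw [hh x, e, pow_add, ← mul_assoc, ← mul_pow, ← aux_sin_sinc, mul_assoc]) hL
  have hq1 : q - 1 + 1 = q := by omega
  simp_rw [auxF_zero, hq1] at hmain
  convert hmain using 2
  rw [aux_half_sum n (by omega)]
  · obtain ⟨p, rfl⟩ : ∃ p, n = p + 1 := ⟨n - 1, by omega⟩
    simp only [Nat.add_sub_cancel, hd]
    rw [Finset.mul_sum, Finset.mul_sum, ← Finset.sum_neg_distrib, Finset.sum_div]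
    apply Finset.sum_congr rfl
    intro k _
    rw [pow_succ]
    field_simp
  · intro k hk
    have e1 : (n : ℝ) - 2 * ((n - k : ℕ) : ℝ) = -((n : ℝ) - 2 * k) := by
      rw [Nat.cast_sub hk]; ring
    have e2 : (-1 : ℝ) ^ (n - k) * (-1) ^ (q - 1) = (-1) ^ k := by
      obtain ⟨r, hr⟩ := hodd
      rw [← pow_add]
      have : (-1 : ℝ) ^ (n - k + (q - 1)) * (-1) ^ k * (-1) ^ k = 1 * (-1) ^ k := by
        rw [← pow_add]
        congr 1
        exact Even.neg_one_pow ⟨r, by omega⟩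
      rw [mul_assoc, ← mul_pow] at this
      simpa using this
    simp only [hd, e1, Real.log_neg_eq_log]
    rw [Nat.choose_symm hk, neg_pow ((n : ℝ) - 2 * k), ← e2]
    ring
  · intro k hk
    have : (n : ℝ) - 2 * k = 0 := by rw [← hk]; push_cast; ring
    simp [this]
end
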